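/- arXiv:2404.05738 — 2 statements merged into one kernel-verified Lean document; each statement's English description precedes it below -/
import Mathlib

section
/- Let x ∈ ℂ with x³ ≠ 1 and take (a,b,c) = (1,2,3). Then for every integer n ≥ 0, BJ(n) = x^(n+1)·(1 + x·j1 + x²·j2 + x³·j3)/(x² + x + 1) - ω1^(n+1)·(1 + ω1·j1 + ω2·j2 + j3)/((x - ω1)·(ω1 - ω2)) + ω2^(n+1)·(1 + ω2·j1 + ω1·j2 + j3)/((x - ω2)·(ω1 - ω2)) in H. -/
noncomputable section

/-- The bihyperbolic numbers over `ℂ`: the group algebra of the Klein four-group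
`(ZMod 2 × ZMod 2, +)` over `ℂ`.  Its `ℂ`-basis is `1, j1, j2, j3` with
`j1² = j2² = j3² = 1`, `j1*j2 = j3`, `j1*j3 = j2`, `j2*j3 = j1`. -/
abbrev H : Type := AddMonoidAlgebra ℂ (ZMod 2 × ZMod 2)

def j1 : H := AddMonoidAlgebra.single (1, 0) 1
def j2 : H := AddMonoidAlgebra.single (0, 1) 1
def j3 : H := AddMonoidAlgebra.single (1, 1) 1

/-- The third-order Jacobsthal polynomial sequence (evaluated at `x : ℂ`). -/
def J (x : ℂ) : ℕ → ℂ
  | 0 => 0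
  | 1 => 1
  | 2 => x - 1
  | n + 3 => (x - 1) * J x (n + 2) + (x - 1) * J x (n + 1) + x * J x n

/-- The generalized bihyperbolic third-order Jacobsthal polynomial
`BJ_n^{(a,b,c)}(x) = J_n(x) + J_{n+a}(x) j1 + J_{n+b}(x) j2 + J_{n+c}(x) j3`. -/
def BJ (x : ℂ) (a b c n : ℕ) : H :=
  algebraMap ℂ H (J x n) + algebraMap ℂ H (J x (n + a)) * j1
    + algebraMap ℂ H (J x (n + b)) * j2 + algebraMap ℂ H (J x (n + c)) * j3

/-- The Binet formula for the scalar sequence `J`. -/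
theorem J_binet (x : ℂ) (hx : x ^ 3 ≠ 1)
    (ω1 ω2 : ℂ) (hω1 : ω1 ^ 2 + ω1 + 1 = 0) (hω2 : ω2 ^ 2 + ω2 + 1 = 0)
    (hω : ω1 ≠ ω2) (n : ℕ) :
    J x n = x ^ (n + 1) / (x ^ 2 + x + 1)
      - ω1 ^ (n + 1) / ((x - ω1) * (ω1 - ω2))
      + ω2 ^ (n + 1) / ((x - ω2) * (ω1 - ω2)) := by
  have hd : ω1 - ω2 ≠ 0 := sub_ne_zero.mpr hω
  have hsum : ω1 + ω2 + 1 = 0 :=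
    mul_left_cancel₀ hd (by linear_combination hω1 - hω2)
  have hq : x ^ 2 + x + 1 = (x - ω1) * (x - ω2) := by
    linear_combination (x - ω1) * hsum + hω1
  have hq0 : (x - ω1) * (x - ω2) ≠ 0 := fun h =>
    hx (by linear_combination (x - 1) * (hq.trans h))
  have h1 : x - ω1 ≠ 0 := left_ne_zero_of_mul hq0
  have h2 : x - ω2 ≠ 0 := right_ne_zero_of_mul hq0
  rw [hq]
  induction n using J.induct with
  | case1 =>
    rw [J]
    field_simp
    ring
  | case2 =>
    rw [J]
    field_simp
    ring
  | case3 =>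
    rw [J]
    field_simp
    linear_combination (-(ω1 - ω2) * (x - ω1) * (x - ω2)) * hsum
  | case4 n ih2 ih1 ih0 =>
    rw [J, ih2, ih1, ih0]
    simp only [Nat.succ_eq_add_one]
    linear_combination
      ω1 ^ (n + 1) / ((x - ω1) * (ω1 - ω2)) * (ω1 - x) * hω1
      - ω2 ^ (n + 1) / ((x - ω2) * (ω1 - ω2)) * (ω2 - x) * hω2

theorem BJ_binet_special (x : ℂ) (hx : x ^ 3 ≠ 1)
    (ω1 ω2 : ℂ) (hω1 : ω1 ^ 2 + ω1 + 1 = 0) (hω2 : ω2 ^ 2 + ω2 + 1 = 0)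
    (hω : ω1 ≠ ω2) (n : ℕ) :
    BJ x 1 2 3 n =
      algebraMap ℂ H (x ^ (n + 1) / (x ^ 2 + x + 1)) *
        (1 + algebraMap ℂ H x * j1 + algebraMap ℂ H (x ^ 2) * j2
          + algebraMap ℂ H (x ^ 3) * j3)
      - algebraMap ℂ H (ω1 ^ (n + 1) / ((x - ω1) * (ω1 - ω2))) *
          (1 + algebraMap ℂ H ω1 * j1 + algebraMap ℂ H ω2 * j2 + j3)
      + algebraMap ℂ H (ω2 ^ (n + 1) / ((x - ω2) * (ω1 - ω2))) *
          (1 + algebraMap ℂ H ω2 * j1 + algebraMap ℂ H ω1 * j2 + j3) := by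
  have hsum : ω1 + ω2 + 1 = 0 :=
    mul_left_cancel₀ (sub_ne_zero.mpr hω) (by linear_combination hω1 - hω2)
  have hsq1 : ω1 ^ 2 = ω2 := by linear_combination hω1 - hsum
  have hsq2 : ω2 ^ 2 = ω1 := by linear_combination hω2 - hsum
  have hcube1 : ω1 ^ 3 = 1 := by linear_combination (ω1 - 1) * hω1
  have hcube2 : ω2 ^ 3 = 1 := by linear_combination (ω2 - 1) * hω2
  have hJ := J_binet x hx ω1 ω2 hω1 hω2 hω
  set A := x ^ (n + 1) / (x ^ 2 + x + 1) with hA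
  set B := ω1 ^ (n + 1) / ((x - ω1) * (ω1 - ω2)) with hB
  set C := ω2 ^ (n + 1) / ((x - ω2) * (ω1 - ω2)) with hC
  have hJ0 : J x n = A - B + C := hJ n
  have hJ1 : J x (n + 1) = A * x - B * ω1 + C * ω2 := by
    rw [hJ, hA, hB, hC]
    ring
  have hJ2 : J x (n + 2) = A * x ^ 2 - B * ω2 + C * ω1 := by
    rw [hJ]
    linear_combination -B * hsq1 + C * hsq2
  have hJ3 : J x (n + 3) = A * x ^ 3 - B + C := by
    rw [hJ]
    linear_combination -B * hcube1 + C * hcube2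
  rw [BJ, hJ0, hJ1, hJ2, hJ3]
  simp only [map_add, map_sub, map_mul]
  ring
end
end

section
/- (d'Ocagne identity) Let a, b, c ≥ 1 be integers and let x ∈ ℂ with x ≠ 0 and x³ ≠ 1. Then for all integers n ≥ m ≥ 0, (x² + x + 1)²·(BJ(n+1)·BJ(m) - BJ(n)·BJ(m+1)) = (x² + x + 1)·A(m-n)·Φ1·Φ2 + x^(n+1)·Θ·((Z(m+1) - x·Z(m)) - x^(m-n)·(Z(n+1) - x·Z(n))) in H, where the integer powers x^(m-n), ω1^(m-n), ω2^(m-n) are taken in ℂ using inverses. -/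
noncomputable section

/-- `Θ(y) = 1 + y^a j1 + y^b j2 + y^c j3`; used for `Θ = Th x a b c`,
`Φ1 = Th ω1 a b c`, `Φ2 = Th ω2 a b c`. -/
def Th (y : ℂ) (a b c : ℕ) : H :=
  1 + algebraMap ℂ H (y ^ a) * j1 + algebraMap ℂ H (y ^ b) * j2
    + algebraMap ℂ H (y ^ c) * j3

/-- `Z_n(x) = ((ω1 x - 1) ω1^n Φ1 - (ω2 x - 1) ω2^n Φ2) / (ω1 - ω2)`. -/
def Z (x ω1 ω2 : ℂ) (a b c n : ℕ) : H :=
  algebraMap ℂ H (ω1 - ω2)⁻¹ *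
    (algebraMap ℂ H ((ω1 * x - 1) * ω1 ^ n) * Th ω1 a b c
      - algebraMap ℂ H ((ω2 * x - 1) * ω2 ^ n) * Th ω2 a b c)

/-- `A_k = (ω1^k - ω2^k) / (ω1 - ω2)` for an integer index `k` (integer powers). -/
def Az (ω1 ω2 : ℂ) (k : ℤ) : ℂ := (ω1 ^ k - ω2 ^ k) / (ω1 - ω2)

theorem mul_J_eq (x ω1 ω2 : ℂ) (hω1 : ω1 ^ 2 + ω1 + 1 = 0) (hω2 : ω2 ^ 2 + ω2 + 1 = 0)
    (hω : ω1 ≠ ω2) (n : ℕ) :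
    (x ^ 2 + x + 1) * J x n = x ^ (n + 1)
      - (ω1 - ω2)⁻¹ * ((ω1 * x - 1) * ω1 ^ n - (ω2 * x - 1) * ω2 ^ n) := by
  have hd : ω1 - ω2 ≠ 0 := sub_ne_zero.mpr hω
  have hsum : ω1 + ω2 = -1 := mul_left_cancel₀ hd (by linear_combination hω1 - hω2)
  induction n using J.induct with
  | case1 =>
    simp only [J]
    field_simp
    ring
  | case2 =>
    simp only [J]
    field_simp
    linear_combination (ω1 - ω2) * x * hsum
  | case3 =>
    simp only [J]
    field_simp
    linear_combination x * (ω1 - 1) * hω1 - x * (ω2 - 1) * hω2 - (ω1 - ω2) * hsum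
  | case4 n h2 h1 h0 =>
    simp only [J, Nat.succ_eq_add_one]
    linear_combination (x - 1) * h2 + (x - 1) * h1 + x * h0
      + (ω1 - ω2)⁻¹ * ((ω1 * x - 1) * ω1 ^ n * (ω1 - x) * hω1
        - (ω2 * x - 1) * ω2 ^ n * (ω2 - x) * hω2)

theorem algebraMap_mul_BJ_eq (a b c : ℕ) (x ω1 ω2 : ℂ) (hω1 : ω1 ^ 2 + ω1 + 1 = 0)
    (hω2 : ω2 ^ 2 + ω2 + 1 = 0) (hω : ω1 ≠ ω2) (n : ℕ) :
    algebraMap ℂ H (x ^ 2 + x + 1) * BJ x a b c n =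
      algebraMap ℂ H (x ^ (n + 1)) * Th x a b c - Z x ω1 ω2 a b c n := by
  have key (k : ℕ) := congrArg (algebraMap ℂ H) (mul_J_eq x ω1 ω2 hω1 hω2 hω k)
  simp only [map_mul, map_sub, map_pow] at key
  simp only [BJ, Th, Z, map_mul, map_sub, map_pow]
  linear_combination key n + key (n + a) * j1 + key (n + b) * j2 + key (n + c) * j3

theorem Z_mul_sub_mul_Z (a b c : ℕ) (x ω1 ω2 : ℂ) (hω1 : ω1 ^ 2 + ω1 + 1 = 0)
    (hω2 : ω2 ^ 2 + ω2 + 1 = 0) (hω : ω1 ≠ ω2) (n m : ℕ) :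
    Z x ω1 ω2 a b c (n + 1) * Z x ω1 ω2 a b c m - Z x ω1 ω2 a b c n * Z x ω1 ω2 a b c (m + 1) =
      algebraMap ℂ H ((x ^ 2 + x + 1) * Az ω1 ω2 ((m : ℤ) - (n : ℤ))) *
        (Th ω1 a b c * Th ω2 a b c) := by
  have hd : ω1 - ω2 ≠ 0 := sub_ne_zero.mpr hω
  have hsum : ω1 + ω2 = -1 := mul_left_cancel₀ hd (by linear_combination hω1 - hω2)
  have hprod : ω1 * ω2 = 1 := by linear_combination ω1 * hsum - hω1
  have h1 : ω1 ≠ 0 := left_ne_zero_of_mul_eq_one hprod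
  have h2 : ω2 ≠ 0 := right_ne_zero_of_mul_eq_one hprod
  have e1 : ω1 ^ ((m : ℤ) - n) = ω1 ^ m * ω2 ^ n := by
    rw [zpow_sub₀ h1, zpow_natCast, zpow_natCast, div_eq_iff (pow_ne_zero _ h1), mul_assoc,
      ← mul_pow, mul_comm ω2, hprod, one_pow, mul_one]
  have e2 : ω2 ^ ((m : ℤ) - n) = ω2 ^ m * ω1 ^ n := by
    rw [zpow_sub₀ h2, zpow_natCast, zpow_natCast, div_eq_iff (pow_ne_zero _ h2), mul_assoc,
      ← mul_pow, hprod, one_pow, mul_one]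
  have hs : x ^ 2 + x + 1 = (ω1 * x - 1) * (ω2 * x - 1) := by
    linear_combination (-x ^ 2) * hprod + x * hsum
  have hinv := congrArg (algebraMap ℂ H) (inv_mul_cancel₀ hd)
  rw [Az, e1, e2, hs, div_eq_mul_inv]
  simp only [Z, map_mul, map_sub, map_pow, map_one] at hinv ⊢
  generalize algebraMap ℂ H (ω1 - ω2)⁻¹ = d at *
  linear_combination d * (algebraMap ℂ H ω1 * algebraMap ℂ H x - 1) *
    (algebraMap ℂ H ω2 * algebraMap ℂ H x - 1) * Th ω1 a b c * Th ω2 a b c *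
    (algebraMap ℂ H ω1 ^ m * algebraMap ℂ H ω2 ^ n
      - algebraMap ℂ H ω2 ^ m * algebraMap ℂ H ω1 ^ n) * hinv

theorem BJ_dOcagne (a b c : ℕ) (ha : 1 ≤ a) (hb : 1 ≤ b) (hc : 1 ≤ c) (x : ℂ) (hx0 : x ≠ 0) (hx : x ^ 3 ≠ 1)
    (ω1 ω2 : ℂ) (hω1 : ω1 ^ 2 + ω1 + 1 = 0) (hω2 : ω2 ^ 2 + ω2 + 1 = 0)
    (hω : ω1 ≠ ω2) (n m : ℕ) (hmn : m ≤ n) :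
    algebraMap ℂ H ((x ^ 2 + x + 1) ^ 2) *
        (BJ x a b c (n + 1) * BJ x a b c m - BJ x a b c n * BJ x a b c (m + 1)) =
      algebraMap ℂ H ((x ^ 2 + x + 1) * Az ω1 ω2 ((m : ℤ) - (n : ℤ))) *
        (Th ω1 a b c * Th ω2 a b c)
      + algebraMap ℂ H (x ^ (n + 1)) * Th x a b c *
          ((Z x ω1 ω2 a b c (m + 1) - algebraMap ℂ H x * Z x ω1 ω2 a b c m)
            - algebraMap ℂ H (x ^ ((m : ℤ) - (n : ℤ))) *
              (Z x ω1 ω2 a b c (n + 1) - algebraMap ℂ H x * Z x ω1 ω2 a b c n)) := by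
  have hB := algebraMap_mul_BJ_eq a b c x ω1 ω2 hω1 hω2 hω
  have hpow : algebraMap ℂ H (x ^ (n + 1)) * algebraMap ℂ H (x ^ ((m : ℤ) - n)) =
      algebraMap ℂ H (x ^ (m + 1)) := by
    rw [← map_mul, zpow_sub₀ hx0, zpow_natCast, zpow_natCast]
    congr 1
    field_simp
    ring
  rw [← Z_mul_sub_mul_Z a b c x ω1 ω2 hω1 hω2 hω n m]
  calc
    _ = (algebraMap ℂ H (x ^ 2 + x + 1) * BJ x a b c (n + 1)) *
          (algebraMap ℂ H (x ^ 2 + x + 1) * BJ x a b c m)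
        - (algebraMap ℂ H (x ^ 2 + x + 1) * BJ x a b c n) *
          (algebraMap ℂ H (x ^ 2 + x + 1) * BJ x a b c (m + 1)) := by
      rw [map_pow]
      ring
    _ = _ := by
      simp only [hB]
      simp only [map_pow] at hpow ⊢
      linear_combination Th x a b c *
        (Z x ω1 ω2 a b c (n + 1) - algebraMap ℂ H x * Z x ω1 ω2 a b c n) * hpow
end
end
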